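/- For every y ∈ C²(cl(B₁); ℝ³) and all 0<a<b<1, ∫_{B_b∖B_a} |D²y|² dL² ≥ 2 | ∫_a^b (1/r) ( ∫_{B_r} Σ_{i=1}^{3} det D²y_i dL² ) dr |. -/

import Mathlib

open MeasureTheory Metric Real Filter Matrix
open scoped ENNReal Topology

noncomputable section

/-- The plane `ℝ²` with the Euclidean norm. -/
abbrev E2 : Type := EuclideanSpace ℝ (Fin 2)
/-- The space `ℝ³` with the Euclidean norm. -/
abbrev E3 : Type := EuclideanSpace ℝ (Fin 3)

/-- The `i`-th standard basis vector of `ℝ²`. -/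
def e2 (i : Fin 2) : E2 := EuclideanSpace.single i 1

/-- Partial derivative in the direction of the `i`-th coordinate. -/
def pd (i : Fin 2) (f : E2 → ℝ) (x : E2) : ℝ := fderiv ℝ f x (e2 i)

/-- Hessian matrix of a scalar function on `ℝ²`. -/
def hess (f : E2 → ℝ) (x : E2) : Matrix (Fin 2) (Fin 2) ℝ :=
  Matrix.of fun i j => pd i (pd j f) x

/-- Derivative matrix `Dy ∈ ℝ^{3×2}` of a map `y : ℝ² → ℝ³`. -/
def Dmat (y : E2 → E3) (x : E2) : Matrix (Fin 3) (Fin 2) ℝ :=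
  Matrix.of fun i j => pd j (fun z => y z i) x

/-- Induced metric `g_y = (Dy)ᵀ Dy`. -/
def gmet (y : E2 → E3) (x : E2) : Matrix (Fin 2) (Fin 2) ℝ :=
  (Dmat y x)ᵀ * Dmat y x

/-- The rotated vector `x⊥ = (-x₂, x₁)`. -/
def perpVec (x : E2) : Fin 2 → ℝ := ![-(x 1), x 0]

/-- The unit tangent `x̂⊥ = (-x₂, x₁)/|x|`. -/
def xperpUnit (x : E2) : Fin 2 → ℝ := fun i => perpVec x i / ‖x‖

/-- The reference (cone) metric `g_Δ = Id - Δ² x̂⊥ ⊗ x̂⊥`. -/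
def gDelta (Δ : ℝ) (x : E2) : Matrix (Fin 2) (Fin 2) ℝ :=
  1 - Matrix.of fun i j => (Δ ^ 2 / ‖x‖ ^ 2) * perpVec x i * perpVec x j

/-- Squared Frobenius norm of a matrix. -/
def frob2 {m n : Type*} [Fintype m] [Fintype n] (A : Matrix m n ℝ) : ℝ :=
  ∑ i, ∑ j, (A i j) ^ 2

/-- `|D²y|²`: the sum of the squared Frobenius norms of the Hessians of the components. -/
def hessNormSq (y : E2 → E3) (x : E2) : ℝ :=
  ∑ i : Fin 3, frob2 (hess (fun z => y z i) x)

/-- The free elastic energy `I_{h,Δ}(y)`. -/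
def energy (h Δ : ℝ) (y : E2 → E3) : ℝ :=
  ∫ x in ball (0 : E2) 1, (frob2 (gmet y x - gDelta Δ x) + h ^ 2 * hessNormSq y x)

/-- The singular cone `y^Δ(x) = √(1-Δ²)·(x,0) + Δ|x| e₃`. -/
def coneMap (Δ : ℝ) (x : E2) : E3 :=
  (WithLp.equiv 2 (Fin 3 → ℝ)).symm
    ![Real.sqrt (1 - Δ ^ 2) * x 0, Real.sqrt (1 - Δ ^ 2) * x 1, Δ * ‖x‖]



lemma memLp_two_of_cont {f : ℝ → ℂ} (hf : Continuous f) (a b : ℝ) :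
    MemLp f 2 (volume.restrict (Set.Ioc a b)) := by
  obtain ⟨C, hC⟩ := (isCompact_Icc (a := a) (b := b)).exists_bound_of_continuousOn hf.continuousOn
  refine MemLp.of_bound hf.aestronglyMeasurable C ?_
  filter_upwards [ae_restrict_mem measurableSet_Ioc] with x hx
  exact hC x (Set.Ioc_subset_Icc_self hx)

lemma wirtinger (u u' : ℝ → ℝ) (hu : ∀ x, HasDerivAt u (u' x) x) (hu' : Continuous u')
    (hper : u (-π) = u π) (hmean : ∫ x in (-π)..π, u x = 0) :
    ∫ x in (-π)..π, u x ^ 2 ≤ ∫ x in (-π)..π, u' x ^ 2 := by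
  have hab : -π < π := by linarith [pi_pos]
  have huc : Continuous u := continuous_iff_continuousAt.2 fun x => (hu x).continuousAt
  set f : ℝ → ℂ := fun x => (u x : ℂ) with hf
  set f' : ℝ → ℂ := fun x => (u' x : ℂ) with hf'
  have hfc : Continuous f := by fun_prop
  have hfc' : Continuous f' := by fun_prop
  have h1 := hasSum_sq_fourierCoeffOn hab (memLp_two_of_cont hfc _ _)
  have h2 := hasSum_sq_fourierCoeffOn hab (memLp_two_of_cont hfc' _ _)
  have key : ∀ n : ℤ, ‖fourierCoeffOn hab f n‖ ^ 2 ≤ ‖fourierCoeffOn hab f' n‖ ^ 2 := by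
    intro n
    rcases eq_or_ne n 0 with rfl | hn
    · have : fourierCoeffOn hab f 0 = 0 := by
        rw [fourierCoeffOn_eq_integral]
        simp only [neg_zero, fourier_zero, one_smul, hf]
        rw [intervalIntegral.integral_ofReal, hmean]; simp
      rw [this]; simp; 
    · rw [fourierCoeffOn_of_hasDerivAt hab hn (fun x _ => (hu x).ofReal_comp)
        (hfc'.intervalIntegrable _ _)]
      have hp : (π : ℂ) ≠ 0 := by exact_mod_cast pi_ne_zero
      have hn' : (n : ℂ) ≠ 0 := by exact_mod_cast hn
      have e : 1 / (-2 * π * Complex.I * n) * (fourier (-n) ((-π : ℝ) : AddCircle (π - -π)) *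
          (f π - f (-π)) - ((π : ℝ) - (-π : ℝ)) * fourierCoeffOn hab f' n)
          = (1 / (Complex.I * n)) * fourierCoeffOn hab f' n := by
        simp only [hf, hper, sub_self, mul_zero, zero_sub]
        field_simp
        push_cast
        ring
      push_cast at e ⊢
      rw [e, norm_mul, mul_pow]
      have h3 : ‖(1 / (Complex.I * n) : ℂ)‖ ≤ 1 := by
        simp only [norm_div, norm_one, norm_mul, Complex.norm_I, one_mul, Complex.norm_intCast]
        have : (1:ℝ) ≤ |(n:ℝ)| := by exact_mod_cast Int.one_le_abs hn
        rw [div_le_one (by linarith)]; exact this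
      have : ‖(1 / (Complex.I * n) : ℂ)‖ ^ 2 ≤ 1 := pow_le_one₀ (norm_nonneg _) h3
      nlinarith [sq_nonneg ‖fourierCoeffOn hab f' n‖]
  have h3 := hasSum_le key h1 h2
  simp only [smul_eq_mul, hf, hf', Complex.norm_real, norm_eq_abs, sq_abs] at h3
  have : 0 < (π - -π)⁻¹ := by rw [inv_pos]; linarith
  exact le_of_mul_le_mul_left h3 this

lemma isoper (u u' v v' : ℝ → ℝ) (hu : ∀ x, HasDerivAt u (u' x) x) (hu' : Continuous u')
    (hv : ∀ x, HasDerivAt v (v' x) x) (hv' : Continuous v')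
    (hper : u (-π) = u π) (hperv : v (-π) = v π) :
    |∫ x in (-π)..π, u x * v' x| ≤ 1 / 2 * ∫ x in (-π)..π, (u' x ^ 2 + v' x ^ 2) := by
  have hab : -π ≤ π := by linarith [pi_pos]
  have huc : Continuous u := continuous_iff_continuousAt.2 fun x => (hu x).continuousAt
  set m : ℝ := (∫ x in (-π)..π, u x) / (2 * π) with hm
  have hw := wirtinger (fun x => u x - m) u' (fun x => (hu x).sub_const m) hu' (by simp [hper])
    (by
      rw [intervalIntegral.integral_sub (huc.intervalIntegrable _ _) (by simp)]
      simp only [intervalIntegral.integral_const, smul_eq_mul, hm]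
      field_simp
      ring)
  have h0 : ∫ x in (-π)..π, v' x = 0 := by
    rw [intervalIntegral.integral_eq_sub_of_hasDerivAt (fun x _ => hv x)
      (hv'.intervalIntegrable _ _), hperv, sub_self]
  have e : ∫ x in (-π)..π, u x * v' x = ∫ x in (-π)..π, (u x - m) * v' x := by
    simp only [sub_mul]
    have c1 : Continuous fun x => u x * v' x := by fun_prop
    have c2 : Continuous fun x => m * v' x := by fun_prop
    rw [intervalIntegral.integral_sub (c1.intervalIntegrable _ _) (c2.intervalIntegrable _ _),
      intervalIntegral.integral_const_mul, h0]; simp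
  rw [e]
  have c1 : Continuous fun x => (u x - m) ^ 2 := by fun_prop
  have c2 : Continuous fun x => v' x ^ 2 := by fun_prop
  have c3 : Continuous fun x => u' x ^ 2 := by fun_prop
  calc |∫ x in (-π)..π, (u x - m) * v' x| ≤ ∫ x in (-π)..π, |(u x - m) * v' x| :=
        intervalIntegral.abs_integral_le_integral_abs hab
    _ ≤ ∫ x in (-π)..π, (1 / 2) * ((u x - m) ^ 2 + v' x ^ 2) := by
        apply intervalIntegral.integral_mono_on hab
        · exact Continuous.intervalIntegrable (by fun_prop) _ _
        · exact Continuous.intervalIntegrable (by fun_prop) _ _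
        · intro x _
          rw [abs_le]
          constructor <;> nlinarith [sq_nonneg (u x - m - v' x), sq_nonneg (u x - m + v' x)]
    _ = (1 / 2) * ((∫ x in (-π)..π, (u x - m) ^ 2) + ∫ x in (-π)..π, v' x ^ 2) := by
        rw [intervalIntegral.integral_const_mul, intervalIntegral.integral_add
          (c1.intervalIntegrable _ _) (c2.intervalIntegrable _ _)]
    _ ≤ _ := by
        rw [intervalIntegral.integral_add (c3.intervalIntegrable _ _) (c2.intervalIntegrable _ _)]
        linarith

lemma bound_aux (f : ℝ → ℝ → ℝ) (hf : Continuous f.uncurry) (r : ℝ) :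
    ∃ C, ∀ s ∈ Set.Icc (r-1) (r+1), ∀ θ ∈ Set.Icc (-π) π, |f s θ| ≤ C := by
  obtain ⟨C, hC⟩ := (isCompact_Icc.prod isCompact_Icc :
    IsCompact (Set.Icc (r-1) (r+1) ×ˢ Set.Icc (-π) π)).exists_bound_of_continuousOn
    hf.continuousOn
  exact ⟨C, fun s hs θ hθ => hC (s, θ) ⟨hs, hθ⟩⟩

lemma area_deriv (U Ur Ut V Vr Vt : ℝ → ℝ → ℝ)
    (hUr : ∀ r t, HasDerivAt (fun s => U s t) (Ur r t) r)
    (hUt : ∀ r t, HasDerivAt (fun s => U r s) (Ut r t) t)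
    (hVr : ∀ r t, HasDerivAt (fun s => V s t) (Vr r t) r)
    (hVt : ∀ r t, HasDerivAt (fun s => V r s) (Vt r t) t)
    (cUr : Continuous Ur.uncurry) (cUt : Continuous Ut.uncurry)
    (cVr : Continuous Vr.uncurry) (cVt : Continuous Vt.uncurry)
    (pU : ∀ r, U r (-π) = U r π) (pV : ∀ r, V r (-π) = V r π) (r : ℝ) :
    HasDerivAt (fun s => ∫ t in (-π)..π, U s t * Vt s t)
      (∫ t in (-π)..π, (Ur r t * Vt r t - Ut r t * Vr r t)) r := by
  have hab : -π ≤ π := by linarith [pi_pos]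
  have cU : ∀ s, Continuous (U s) := fun s =>
    continuous_iff_continuousAt.2 fun x => (hUt s x).continuousAt
  have cV : ∀ s, Continuous (V s) := fun s =>
    continuous_iff_continuousAt.2 fun x => (hVt s x).continuousAt
  have cUt' : ∀ s, Continuous (Ut s) := fun s => cUt.comp (by fun_prop : Continuous fun t => (s, t))
  have cVt' : ∀ s, Continuous (Vt s) := fun s => cVt.comp (by fun_prop : Continuous fun t => (s, t))
  rw [hasDerivAt_iff_tendsto_slope]
  have e : ∀ s, slope (fun s => ∫ t in (-π)..π, U s t * Vt s t) r s
      = ∫ t in (-π)..π, (slope (fun s => U s t) r s * Vt s t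
          - Ut r t * slope (fun s => V s t) r s) := by
    intro s
    have ibp := intervalIntegral.integral_mul_deriv_eq_deriv_mul
      (u := U r) (u' := Ut r) (v := fun t => V s t - V r t) (v' := fun t => Vt s t - Vt r t)
      (a := -π) (b := π) (fun x _ => hUt r x) (fun x _ => (hVt s x).sub (hVt r x))
      ((cUt' r).intervalIntegrable _ _) (((cVt' s).sub (cVt' r)).intervalIntegrable _ _)
    simp only [pU, pV, sub_self, zero_sub] at ibp
    simp only [slope_def_field]
    have := cU s; have := cU r; have := cV s; have := cV r; have := cVt' s; have := cUt' r
    have := cVt' r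
    have c1 : Continuous fun t => U s t * Vt s t := by fun_prop
    have c2 : Continuous fun t => U r t * Vt r t := by fun_prop
    have c3 : Continuous fun t => (U s t - U r t) * Vt s t := by fun_prop
    have c4 : Continuous fun t => Ut r t * (V s t - V r t) := by fun_prop
    have c5 : Continuous fun t => U r t * (Vt s t - Vt r t) := by fun_prop
    rw [← intervalIntegral.integral_sub
      (c1.intervalIntegrable _ _) (c2.intervalIntegrable _ _)]
    have e1 : ∫ t in (-π)..π, (U s t * Vt s t - U r t * Vt r t)
        = ∫ t in (-π)..π, ((U s t - U r t) * Vt s t - Ut r t * (V s t - V r t)) := by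
      rw [intervalIntegral.integral_sub (c3.intervalIntegrable _ _) (c4.intervalIntegrable _ _),
        sub_eq_add_neg, ← ibp, ← intervalIntegral.integral_add
        (c3.intervalIntegrable _ _) (c5.intervalIntegrable _ _)]
      congr 1; ext t; ring
    rw [e1, ← intervalIntegral.integral_div]
    congr 1; ext t; ring
  simp only [funext e]
  obtain ⟨C1, h1⟩ := bound_aux Ur cUr r
  obtain ⟨C2, h2⟩ := bound_aux Ut cUt r
  obtain ⟨C3, h3⟩ := bound_aux Vr cVr r
  obtain ⟨C4, h4⟩ := bound_aux Vt cVt r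
  have hr : r ∈ Set.Icc (r-1) (r+1) := ⟨by linarith, by linarith⟩
  have mv : ∀ (W Wr : ℝ → ℝ → ℝ) (C : ℝ), (∀ r t, HasDerivAt (fun s => W s t) (Wr r t) r) →
      (∀ s ∈ Set.Icc (r-1) (r+1), ∀ θ ∈ Set.Icc (-π) π, |Wr s θ| ≤ C) →
      ∀ s ∈ Set.Icc (r-1) (r+1), ∀ θ ∈ Set.Icc (-π) π, |slope (fun s => W s θ) r s| ≤ C := by
    intro W Wr C hW hC s hs θ hθ
    have h := Convex.norm_image_sub_le_of_norm_hasDerivWithin_le (s := Set.Icc (r-1) (r+1))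
      (f := fun s => W s θ) (f' := fun s => Wr s θ) (C := C)
      (fun x _ => (hW x θ).hasDerivWithinAt) (fun x hx => hC x hx θ hθ) (convex_Icc _ _) hr hs
    rw [slope_def_field, abs_div]
    have hC0 : 0 ≤ C := (abs_nonneg _).trans (hC r hr θ hθ)
    exact div_le_of_le_mul₀ (abs_nonneg _) hC0 h
  apply intervalIntegral.tendsto_integral_filter_of_dominated_convergence (fun _ => C1 * C4 + C2 * C3)
  · refine Eventually.of_forall fun s => Continuous.aestronglyMeasurable ?_
    simp only [slope_def_field]
    have := cU s; have := cU r; have := cV s; have := cV r; have := cVt' s; have := cUt' r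
    fun_prop
  · have : ∀ᶠ s in 𝓝[≠] r, s ∈ Set.Icc (r-1) (r+1) :=
      mem_nhdsWithin_of_mem_nhds (Icc_mem_nhds (by linarith) (by linarith))
    filter_upwards [this] with s hs
    refine Eventually.of_forall fun t ht => ?_
    rw [Set.uIoc_of_le hab] at ht
    have ht' := Set.Ioc_subset_Icc_self ht
    have a1 := mv U Ur C1 hUr h1 s hs t ht'
    have a2 := mv V Vr C3 hVr h3 s hs t ht'
    have a3 := h4 s hs t ht'
    have a4 := h2 r hr t ht'
    rw [norm_eq_abs]
    refine (abs_sub _ _).trans ?_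
    rw [abs_mul, abs_mul]
    gcongr
    · exact (abs_nonneg _).trans a1
    · exact (abs_nonneg _).trans a4
  · simp
  · refine Eventually.of_forall fun t _ => ?_
    have a1 := (hasDerivAt_iff_tendsto_slope.1 (hUr r t))
    have a2 := (hasDerivAt_iff_tendsto_slope.1 (hVr r t))
    have a3 : Tendsto (fun s => Vt s t) (𝓝[≠] r) (𝓝 (Vt r t)) :=
      ((cVt.comp (by fun_prop : Continuous fun s => (s, t))).tendsto r).mono_left nhdsWithin_le_nhds
    exact (a1.mul a3).sub (a2.const_mul _)

/-- polar parametrisation -/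
def polP (r t : ℝ) : E2 := (r * cos t) • e2 0 + (r * sin t) • e2 1

lemma polP_zero (r t : ℝ) : polP r t 0 = r * cos t := by simp [polP, e2]
lemma polP_one (r t : ℝ) : polP r t 1 = r * sin t := by simp [polP, e2]

lemma polP_norm (r t : ℝ) (hr : 0 ≤ r) : ‖polP r t‖ = r := by
  rw [EuclideanSpace.norm_eq, Fin.sum_univ_two, polP_zero, polP_one]
  rw [norm_eq_abs, norm_eq_abs, sq_abs, sq_abs]
  have : (r * cos t) ^ 2 + (r * sin t) ^ 2 = r ^ 2 := by
    nlinarith [sin_sq_add_cos_sq t]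
  rw [this, sqrt_sq hr]

lemma polP_cont : Continuous (Function.uncurry polP) := by
  unfold polP Function.uncurry
  fun_prop

lemma polar_int (g : E2 → ℝ) (hg : Continuous g) (a b : ℝ) (ha : 0 ≤ a) (hab : a ≤ b) :
    ∫ x in ball (0 : E2) b \ ball 0 a, g x
      = ∫ r in a..b, r * ∫ t in (-π)..π, g (polP r t) := by
  have hπ : -π ≤ π := by linarith [pi_pos]
  have hS : MeasurableSet (ball (0 : E2) b \ ball 0 a) := measurableSet_ball.diff measurableSet_ball
  set G : E2 → ℝ := (ball (0 : E2) b \ ball 0 a).indicator g with hG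
  have mp : MeasurePreserving ((MeasurableEquiv.toLp 2 (Fin 2 → ℝ)).symm.trans
      MeasurableEquiv.finTwoArrow) (volume : Measure E2) (volume : Measure (ℝ × ℝ)) :=
    (EuclideanSpace.volume_preserving_symm_measurableEquiv_toLp (Fin 2)).trans
      (volume_preserving_finTwoArrow ℝ)
  rw [← integral_indicator hS, ← hG, ← mp.symm.integral_comp' G, ← integral_comp_polarCoord_symm]
  have hP : ∀ p : ℝ × ℝ, ((MeasurableEquiv.toLp 2 (Fin 2 → ℝ)).symm.trans
      MeasurableEquiv.finTwoArrow).symm (polarCoord.symm p) = polP p.1 p.2 := by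
    intro p
    rw [MeasurableEquiv.symm_apply_eq]
    ext
    · exact (polP_zero _ _).symm
    · exact (polP_one _ _).symm
  simp only [hP, smul_eq_mul]
  have hA : MeasurableSet (Set.Ico a b ×ˢ (Set.univ : Set ℝ)) :=
    measurableSet_Ico.prod MeasurableSet.univ
  have e1 : ∫ p in polarCoord.target, p.1 * G (polP p.1 p.2)
      = ∫ p in polarCoord.target, (Set.Ico a b ×ˢ (Set.univ : Set ℝ)).indicator
          (fun p => p.1 * g (polP p.1 p.2)) p := by
    refine setIntegral_congr_fun polarCoord.open_target.measurableSet fun p hp => ?_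
    have hp0 : 0 < p.1 := hp.1
    have hm : polP p.1 p.2 ∈ ball (0 : E2) b \ ball 0 a ↔ p ∈ Set.Ico a b ×ˢ (Set.univ : Set ℝ) := by
      simp [polP_norm _ _ hp0.le, and_comm]
    by_cases h : p ∈ Set.Ico a b ×ˢ (Set.univ : Set ℝ)
    · simp only [hG, Set.indicator_of_mem h, Set.indicator_of_mem (hm.2 h)]
    · simp only [hG, Set.indicator_of_notMem h, Set.indicator_of_notMem (mt hm.1 h), mul_zero]
  rw [e1, setIntegral_indicator hA]
  have e2 : polarCoord.target ∩ Set.Ico a b ×ˢ (Set.univ : Set ℝ)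
      = (Set.Ioi 0 ∩ Set.Ico a b) ×ˢ Set.Ioo (-π) π := by
    ext p; simp [polarCoord_target]; tauto
  have hc : Continuous fun p : ℝ × ℝ => p.1 * g (polP p.1 p.2) :=
    continuous_fst.mul (hg.comp polP_cont)
  rw [e2, Measure.volume_eq_prod, setIntegral_prod]
  · have e3 : (Set.Ioi 0 ∩ Set.Ico a b : Set ℝ) =ᵐ[volume] Set.Ioc a b := by
      have h1 : (Set.Ioi 0 ∩ Set.Ico a b : Set ℝ) =ᵐ[volume] (Set.Ici 0 ∩ Set.Ico a b : Set ℝ) :=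
        ae_eq_set_inter Ioi_ae_eq_Ici (ae_eq_refl _)
      have h2 : (Set.Ici 0 ∩ Set.Ico a b : Set ℝ) = Set.Ico a b :=
        Set.inter_eq_right.2 fun x hx => ha.trans hx.1
      rw [h2] at h1
      exact h1.trans Ico_ae_eq_Ioc
    rw [setIntegral_congr_set e3, intervalIntegral.integral_of_le hab]
    congr 1; ext r
    rw [setIntegral_congr_set Ioo_ae_eq_Ioc, integral_const_mul, intervalIntegral.integral_of_le hπ]
  · refine IntegrableOn.mono_set
      (hc.continuousOn.integrableOn_compact (isCompact_Icc.prod isCompact_Icc))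
      (Set.prod_mono (fun x hx => Set.Ico_subset_Icc_self hx.2) Set.Ioo_subset_Icc_self)

lemma ball_int (g : E2 → ℝ) (hg : Continuous g) (b : ℝ) (hb : 0 ≤ b) :
    ∫ x in ball (0 : E2) b, g x = ∫ r in (0:ℝ)..b, r * ∫ t in (-π)..π, g (polP r t) := by
  rw [← polar_int g hg 0 b le_rfl hb]; simp

lemma polP_deriv_r (u : E2 → ℝ) (hu : ContDiff ℝ 1 u) (r t : ℝ) :
    HasDerivAt (fun s => u (polP s t))
      (pd 0 u (polP r t) * cos t + pd 1 u (polP r t) * sin t) r := by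
  have h1 : HasDerivAt (fun s => polP s t) (cos t • e2 0 + sin t • e2 1) r := by
    unfold polP
    have h := (((hasDerivAt_id r).mul_const (cos t)).smul_const (e2 0)).add
      (((hasDerivAt_id r).mul_const (sin t)).smul_const (e2 1))
    rw [one_mul, one_mul] at h
    exact h
  have h2 := (hu.differentiable one_ne_zero (polP r t)).hasFDerivAt.comp_hasDerivAt r h1
  have e : pd 0 u (polP r t) * cos t + pd 1 u (polP r t) * sin t
      = fderiv ℝ u (polP r t) (cos t • e2 0 + sin t • e2 1) := by
    rw [map_add, map_smul, map_smul]; simp only [pd, smul_eq_mul]; ring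
  rw [e]
  exact h2

lemma polP_deriv_t (u : E2 → ℝ) (hu : ContDiff ℝ 1 u) (r t : ℝ) :
    HasDerivAt (fun s => u (polP r s))
      (r * (pd 1 u (polP r t) * cos t - pd 0 u (polP r t) * sin t)) t := by
  have h1 : HasDerivAt (fun s => polP r s) ((r * -sin t) • e2 0 + (r * cos t) • e2 1) t := by
    unfold polP
    exact (((hasDerivAt_cos t).const_mul r).smul_const (e2 0)).add
      (((hasDerivAt_sin t).const_mul r).smul_const (e2 1))
  have h2 := (hu.differentiable one_ne_zero (polP r t)).hasFDerivAt.comp_hasDerivAt t h1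
  have e : r * (pd 1 u (polP r t) * cos t - pd 0 u (polP r t) * sin t)
      = fderiv ℝ u (polP r t) ((r * -sin t) • e2 0 + (r * cos t) • e2 1) := by
    rw [map_add, map_smul, map_smul]; simp only [pd, smul_eq_mul]; ring
  rw [e]
  exact h2

lemma pd_cont (i : Fin 2) (u : E2 → ℝ) (hu : ContDiff ℝ 1 u) : Continuous (pd i u) := by
  unfold pd
  exact (hu.continuous_fderiv one_ne_zero).clm_apply continuous_const

lemma pd_contDiff (i : Fin 2) (u : E2 → ℝ) (hu : ContDiff ℝ 2 u) : ContDiff ℝ 1 (pd i u) := by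
  unfold pd
  exact (hu.fderiv_right (m := 1) (by norm_num)).clm_apply contDiff_const

lemma main_scalar (u v : E2 → ℝ) (hu : ContDiff ℝ 1 u) (hv : ContDiff ℝ 1 v) (r : ℝ) (hr : 0 < r) :
    |∫ x in ball (0 : E2) r, (pd 0 u x * pd 1 v x - pd 1 u x * pd 0 v x)| ≤
      1 / 2 * (r ^ 2 * ∫ t in (-π)..π, (pd 0 u (polP r t) ^ 2 + pd 1 u (polP r t) ^ 2
        + pd 0 v (polP r t) ^ 2 + pd 1 v (polP r t) ^ 2)) := by
  have hπ : -π ≤ π := by linarith [pi_pos]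
  have cP := polP_cont
  have c0u := pd_cont 0 u hu
  have c1u := pd_cont 1 u hu
  have c0v := pd_cont 0 v hv
  have c1v := pd_cont 1 v hv
  have d0u : Continuous fun p : ℝ × ℝ => pd 0 u (polP p.1 p.2) := c0u.comp cP
  have d1u : Continuous fun p : ℝ × ℝ => pd 1 u (polP p.1 p.2) := c1u.comp cP
  have d0v : Continuous fun p : ℝ × ℝ => pd 0 v (polP p.1 p.2) := c0v.comp cP
  have d1v : Continuous fun p : ℝ × ℝ => pd 1 v (polP p.1 p.2) := c1v.comp cP
  have per : ∀ r, polP r (-π) = polP r π := by intro r; simp [polP]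
  set Ut : ℝ → ℝ → ℝ := fun r t => r * (pd 1 u (polP r t) * cos t - pd 0 u (polP r t) * sin t)
    with hUt
  set Vt : ℝ → ℝ → ℝ := fun r t => r * (pd 1 v (polP r t) * cos t - pd 0 v (polP r t) * sin t)
    with hVt
  have cUt : Continuous Ut.uncurry := by
    simp only [hUt, Function.uncurry_def]; fun_prop
  have cVt : Continuous Vt.uncurry := by
    simp only [hVt, Function.uncurry_def]; fun_prop
  have cc : ∀ r : ℝ, Continuous fun t : ℝ => (r, t) := fun r => by fun_prop
  have hA := area_deriv (fun r t => u (polP r t)) _ Ut (fun r t => v (polP r t)) _ Vt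
    (polP_deriv_r u hu) (polP_deriv_t u hu) (polP_deriv_r v hv) (polP_deriv_t v hv)
    (by simp only [Function.uncurry_def]; fun_prop) cUt
    (by simp only [Function.uncurry_def]; fun_prop) cVt
    (fun r => by simp only [per]) (fun r => by simp only [per])
  have hE : ∀ r : ℝ, ∫ t in (-π)..π, ((pd 0 u (polP r t) * cos t + pd 1 u (polP r t) * sin t) * Vt r t
      - Ut r t * (pd 0 v (polP r t) * cos t + pd 1 v (polP r t) * sin t))
      = r * ∫ t in (-π)..π, (pd 0 u (polP r t) * pd 1 v (polP r t)
        - pd 1 u (polP r t) * pd 0 v (polP r t)) := by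
    intro r
    rw [← intervalIntegral.integral_const_mul]
    congr 1; ext t
    simp only [hUt, hVt]
    linear_combination r * (pd 0 u (polP r t) * pd 1 v (polP r t)
        - pd 1 u (polP r t) * pd 0 v (polP r t)) * sin_sq_add_cos_sq t
  simp only [hE] at hA
  have cI : Continuous fun r : ℝ => r * ∫ t in (-π)..π, (pd 0 u (polP r t) * pd 1 v (polP r t)
        - pd 1 u (polP r t) * pd 0 v (polP r t)) := by
    refine continuous_id.mul (intervalIntegral.continuous_parametric_intervalIntegral_of_continuous' ?_ _ _)
    simp only [Function.uncurry_def]; fun_prop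
  have ftc := intervalIntegral.integral_eq_sub_of_hasDerivAt (a := 0) (b := r)
    (fun s _ => hA s) (cI.intervalIntegrable _ _)
  rw [ball_int _ (by fun_prop) r hr.le, ftc]
  have z : ∫ t in (-π)..π, u (polP 0 t) * Vt 0 t = 0 := by simp [hVt]
  rw [z, sub_zero]
  have iso := isoper (fun t => u (polP r t)) (Ut r) (fun t => v (polP r t)) (Vt r)
    (polP_deriv_t u hu r) (cUt.comp (cc r)) (polP_deriv_t v hv r) (cVt.comp (cc r))
    (by simp only [per]) (by simp only [per])
  refine iso.trans ?_
  rw [← intervalIntegral.integral_const_mul (r ^ 2)]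
  gcongr
  have k1 : Continuous (Ut r) := cUt.comp (cc r)
  have k2 : Continuous (Vt r) := cVt.comp (cc r)
  have f0u : Continuous fun t => pd 0 u (polP r t) := d0u.comp (cc r)
  have f1u : Continuous fun t => pd 1 u (polP r t) := d1u.comp (cc r)
  have f0v : Continuous fun t => pd 0 v (polP r t) := d0v.comp (cc r)
  have f1v : Continuous fun t => pd 1 v (polP r t) := d1v.comp (cc r)
  apply intervalIntegral.integral_mono_on hπ
  · exact Continuous.intervalIntegrable (by fun_prop) _ _
  · exact Continuous.intervalIntegrable (by fun_prop) _ _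
  · intro t _
    have key : ∀ p q : ℝ, (r * (q * cos t - p * sin t)) ^ 2 ≤ r ^ 2 * (p ^ 2 + q ^ 2) := by
      intro p q
      have : p ^ 2 + q ^ 2 - (q * cos t - p * sin t) ^ 2 = (p * cos t + q * sin t) ^ 2 := by
        linear_combination (-(p^2+q^2)) * sin_sq_add_cos_sq t
      rw [mul_pow]
      gcongr
      nlinarith [sq_nonneg (p * cos t + q * sin t)]
    have := key (pd 0 u (polP r t)) (pd 1 u (polP r t))
    have := key (pd 0 v (polP r t)) (pd 1 v (polP r t))
    simp only [hUt, hVt]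
    linarith

/-- annulus bending energy dominates the averaged Hessian determinant. -/
theorem stmt_9 (y : E2 → E3) (hy : ContDiff ℝ 2 y) (a b : ℝ)
    (ha : 0 < a) (hab : a < b) (hb : b < 1) :
    2 * |∫ r in a..b,
          (1 / r) * ∫ x in ball (0 : E2) r, ∑ i : Fin 3, (hess (fun z => y z i) x).det|
      ≤ ∫ x in ball (0 : E2) b \ ball 0 a, hessNormSq y x := by
  have hyi : ∀ i, ContDiff ℝ 2 fun z => y z i := fun i => by
    exact (contDiff_euclidean.1 hy) i
  have hp : ∀ i j, ContDiff ℝ 1 (pd j fun z => y z i) := fun i j => pd_contDiff j _ (hyi i)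
  have hpc : ∀ i j k, Continuous (pd k (pd j fun z => y z i)) := fun i j k => pd_cont k _ (hp i j)
  have hdet : ∀ i x, (hess (fun z => y z i) x).det
      = pd 0 (pd 0 fun z => y z i) x * pd 1 (pd 1 fun z => y z i) x
        - pd 1 (pd 0 fun z => y z i) x * pd 0 (pd 1 fun z => y z i) x := by
    intro i x
    rw [Matrix.det_fin_two]; simp only [hess, Matrix.of_apply]; ring
  have hfrob : ∀ i x, frob2 (hess (fun z => y z i) x)
      = pd 0 (pd 0 fun z => y z i) x ^ 2 + pd 1 (pd 0 fun z => y z i) x ^ 2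
        + pd 0 (pd 1 fun z => y z i) x ^ 2 + pd 1 (pd 1 fun z => y z i) x ^ 2 := by
    intro i x
    simp only [frob2, Fin.sum_univ_two, hess, Matrix.of_apply]; ring
  have cdet : ∀ i, Continuous fun x => (hess (fun z => y z i) x).det := by
    intro i
    simp only [hdet]
    have := hpc i 0 0; have := hpc i 0 1; have := hpc i 1 0; have := hpc i 1 1
    fun_prop
  have cfrob : ∀ i, Continuous fun x => frob2 (hess (fun z => y z i) x) := by
    intro i
    simp only [hfrob]
    have := hpc i 0 0; have := hpc i 0 1; have := hpc i 1 0; have := hpc i 1 1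
    fun_prop
  have cH : Continuous (hessNormSq y) := by
    unfold hessNormSq
    exact continuous_finsetSum _ fun i _ => cfrob i
  rw [polar_int _ cH a b ha.le hab.le]
  set K : ℝ → ℝ := fun r => r * ∫ t in (-π)..π, hessNormSq y (polP r t) with hK
  have cK : Continuous K := by
    refine continuous_id.mul (intervalIntegral.continuous_parametric_intervalIntegral_of_continuous' ?_ _ _)
    exact cH.comp polP_cont
  have bound : ∀ r, 0 < r → |(1 / r) * ∫ x in ball (0 : E2) r,
      ∑ i : Fin 3, (hess (fun z => y z i) x).det| ≤ 1 / 2 * K r := by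
    intro r hr
    rw [integral_finsetSum _ fun i _ => ((cdet i).continuousOn.integrableOn_compact
      (isCompact_closedBall (0 : E2) r)).mono_set ball_subset_closedBall]
    have h1 : ∀ i, |∫ x in ball (0 : E2) r, (hess (fun z => y z i) x).det|
        ≤ 1 / 2 * (r ^ 2 * ∫ t in (-π)..π, frob2 (hess (fun z => y z i) (polP r t))) := by
      intro i
      simp only [hdet, hfrob]
      exact main_scalar _ _ (hp i 0) (hp i 1) r hr
    have h2 : |∑ i, ∫ x in ball (0 : E2) r, (hess (fun z => y z i) x).det|
        ≤ 1 / 2 * (r ^ 2 * ∫ t in (-π)..π, hessNormSq y (polP r t)) := by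
      refine (Finset.abs_sum_le_sum_abs _ _).trans ((Finset.sum_le_sum fun i _ => h1 i).trans ?_)
      rw [← Finset.mul_sum, ← Finset.mul_sum]
      unfold hessNormSq
      rw [intervalIntegral.integral_finsetSum]
      intro i _
      exact ((cfrob i).comp (polP_cont.comp
        (by fun_prop : Continuous fun t : ℝ => (r, t)))).intervalIntegrable _ _
    rw [abs_mul, abs_of_pos (by positivity : 0 < 1 / r)]
    calc _ ≤ 1 / r * (1 / 2 * (r ^ 2 * ∫ t in (-π)..π, hessNormSq y (polP r t))) := by gcongr
      _ = _ := by simp only [hK]; field_simp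
  have h3 : ‖∫ r in a..b, (1 / r) * ∫ x in ball (0 : E2) r,
      ∑ i : Fin 3, (hess (fun z => y z i) x).det‖ ≤ ∫ r in a..b, 1 / 2 * K r := by
    refine intervalIntegral.norm_integral_le_of_norm_le hab.le ?_
      ((cK.const_mul (1 / 2)).intervalIntegrable _ _)
    exact Eventually.of_forall fun r hr => bound r (ha.trans hr.1)
  rw [intervalIntegral.integral_const_mul, norm_eq_abs] at h3
  linarith
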